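/- arXiv:1709.09017 — 2 statements merged into one kernel-verified Lean document; each statement's English description precedes it below -/
import Mathlib

section
/- For any multiplicative characters A, B, B', C of F_q and any x ∈ F_q, the finite-field Appell function at y = 1 satisfies F₁(A; B, B'; C; x, 1) = AB'(−1)·binom(B', ĀC)·₂F₁(A, B; CB̄'; x) + (q−1)·Ā(x)·B'(−1)·δ(AC̄B'). -/
open Finset

namespace FFAppell

variable {F : Type*} [Field F] [Fintype F] [DecidableEq F]

/-- The multiplicative characters of a finite field form a finite type. -/
noncomputable instance : Fintype (MulChar F ℂ) := Fintype.ofFinite _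

/-- The Jacobi sum `J(χ, λ) = Σ_{u ∈ F} χ(u)·λ(1−u)`. -/
noncomputable def J (χ lam : MulChar F ℂ) : ℂ := ∑ u : F, χ u * lam (1 - u)

/-- The binomial coefficient `binom(A, B) := B(−1)·J(A, B̄)`. -/
noncomputable def binom (A B : MulChar F ℂ) : ℂ := B (-1) * J A B⁻¹

/-- `δ(χ) = 1` if `χ` is the trivial character, `0` otherwise. -/
noncomputable def δchar (χ : MulChar F ℂ) : ℂ := if χ = 1 then 1 else 0

/-- `δ(x) = 1` if `x = 0`, `0` otherwise. -/
def δ (x : F) : ℂ := if x = 0 then 1 else 0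

/-- The finite-field Gauss hypergeometric function
`₂F₁(A, B; C; x) := ε(x)·BC(−1)·Σ_{y ∈ F} B(y)·B̄C(1−y)·Ā(1−xy)`,
where `ε = 1` is the trivial character (with `ε 0 = 0`). -/
noncomputable def twoF1 (A B C : MulChar F ℂ) (x : F) : ℂ :=
  (1 : MulChar F ℂ) x * (B * C) (-1) *
    ∑ y : F, B y * (B⁻¹ * C) (1 - y) * A⁻¹ (1 - x * y)

/-- The finite-field `₃F₂` function:
`₃F₂(A₀,A₁,A₂; B₁,B₂; x) := (1/(q−1))·Σ_χ binom(A₀χ,χ)·binom(A₁χ,B₁χ)·binom(A₂χ,B₂χ)·χ(x)`. -/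
noncomputable def threeF2 (A₀ A₁ A₂ B₁ B₂ : MulChar F ℂ) (x : F) : ℂ :=
  (1 / ((Fintype.card F : ℂ) - 1)) *
    ∑ χ : MulChar F ℂ, binom (A₀ * χ) χ * binom (A₁ * χ) (B₁ * χ) *
      binom (A₂ * χ) (B₂ * χ) * χ x

/-- The finite-field Appell function `F₁(A; B, B'; C; x, y)`:
`ε(xy)·BB'(−1)·Σ_{u,v ∈ F} B(u)·B'(v)·(C·B̄·B̄')(1−u−v)·Ā(1−ux−vy)`. -/
noncomputable def AppellF1 (A B B' C : MulChar F ℂ) (x y : F) : ℂ :=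
  (1 : MulChar F ℂ) (x * y) * (B * B') (-1) *
    ∑ u : F, ∑ v : F,
      B u * B' v * (C * B⁻¹ * B'⁻¹) (1 - u - v) * A⁻¹ (1 - u * x - v * y)

lemma mulChar_neg_one_mul_self {K : Type*} [Field K] (χ : MulChar K ℂ) : χ (-1) * χ (-1) = 1 := by
  rw [← map_mul]; simp

lemma mulChar_inv_neg_one {K : Type*} [Field K] (χ : MulChar K ℂ) : χ⁻¹ (-1) = χ (-1) := by
  rw [MulChar.inv_apply']; simp

lemma mulChar_neg {K : Type*} [Field K] (χ : MulChar K ℂ) (a : K) : χ (-a) = χ (-1) * χ a := by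
  rw [← map_mul, neg_one_mul]

lemma sum_mulChar_eq_δchar (χ : MulChar F ℂ) :
    ∑ u : F, χ u = ((Fintype.card F : ℂ) - 1) * δchar χ := by
  unfold δchar
  split_ifs with h
  · subst h
    rw [MulChar.sum_one_eq_card_units, Fintype.card_units, Nat.cast_sub Fintype.card_pos]
    simp
  · rw [MulChar.sum_eq_zero_of_ne_one h, mul_zero]

/-- The reflection `v ↦ v / (v - 1)` applied to a Jacobi sum. -/
lemma J_eq_neg_one_mul_J (χ ψ : MulChar F ℂ) : J χ ψ = χ (-1) * J χ (χ * ψ)⁻¹ := by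
  unfold J
  rw [mul_sum]
  have hψ (v : F) (hv : v = 1) (χ ψ : MulChar F ℂ) : χ v * ψ (1 - v) = 0 := by
    rw [hv, sub_self, MulChar.map_zero, mul_zero]
  have hinv (v : F) (hv : v ≠ 1) : v / (v - 1) ≠ 1 ∧ v / (v - 1) / (v / (v - 1) - 1) = v := by
    have h : v - 1 ≠ 0 := sub_ne_zero.mpr hv
    have h' : v / (v - 1) - 1 = 1 / (v - 1) := by field_simp; ring
    refine ⟨fun e => ?_, by rw [h']; field_simp⟩
    rw [e, sub_self] at h'
    exact one_div_ne_zero h h'.symm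
  refine sum_bij_ne_zero (fun v _ _ => v / (v - 1)) (fun _ _ _ => mem_univ _) ?_ ?_ ?_
  · intro v _ hv w _ hw e
    have hv1 : v ≠ 1 := fun e => hv (hψ v e _ _)
    have hw1 : w ≠ 1 := fun e => hw (hψ w e _ _)
    rw [← (hinv v hv1).2, ← (hinv w hw1).2, e]
  · intro w _ hw
    have hw1 : w ≠ 1 := fun e => hw (by rw [hψ w e, mul_zero])
    refine ⟨w / (w - 1), mem_univ _, ?_, (hinv w hw1).2⟩
    have hw0 : w ≠ 0 := by rintro rfl; simp [MulChar.map_zero] at hw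
    have h : w - 1 ≠ 0 := sub_ne_zero.mpr hw1
    have h' : 1 - w / (w - 1) ≠ 0 := sub_ne_zero.mpr (hinv w hw1).1.symm
    exact mul_ne_zero ((div_ne_zero hw0 h).isUnit.map χ).ne_zero
      (h'.isUnit.map ψ).ne_zero
  · intro v _ hv
    have hv1 : v ≠ 1 := fun e => hv (hψ v e _ _)
    have h : v - 1 ≠ 0 := sub_ne_zero.mpr hv1
    have h' : 1 - v ≠ 0 := sub_ne_zero.mpr hv1.symm
    have e1 : (1 - v / (v - 1))⁻¹ = 1 - v := by
      apply inv_eq_of_mul_eq_one_left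
      field_simp
      ring
    rw [MulChar.inv_apply', e1, MulChar.mul_apply, ← mul_assoc, ← mul_assoc, ← map_mul, ← map_mul]
    congr 2
    field_simp
    ring

/-- Rescaling the inner sum of the Appell function at `y = 1` by `u ↦ w u`. -/
lemma sum_mulChar_rescale (χ ψ φ : MulChar F ℂ) (x w : F) :
    ∑ u : F, χ u * ψ (w - u) * φ (w - u * x) =
      (χ * ψ * φ) w * ∑ y : F, χ y * ψ (1 - y) * φ (1 - x * y) +
        if w = 0 then ψ (-1) * φ (-1) * φ x *
          (((Fintype.card F : ℂ) - 1) * δchar (χ * ψ * φ)) else 0 := by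
  split_ifs with hw
  · subst hw
    rw [MulChar.map_zero, zero_mul, zero_add, ← sum_mulChar_eq_δchar, mul_sum]
    refine sum_congr rfl fun u _ => ?_
    rw [zero_sub, zero_sub, mulChar_neg ψ, mulChar_neg φ, map_mul, MulChar.mul_apply,
      MulChar.mul_apply]
    ring
  · rw [add_zero, mul_sum, ← Equiv.sum_comp (Equiv.mulLeft₀ w hw)]
    refine sum_congr rfl fun u _ => ?_
    rw [Equiv.mulLeft₀_apply, show w - w * u = w * (1 - u) by ring,
      show w - w * u * x = w * (1 - x * u) by ring, map_mul, map_mul, map_mul,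
      MulChar.mul_apply, MulChar.mul_apply]
    ring

/-- The finite-field Appell function at `y = 1`. -/
theorem appellF1_at_y_one (A B B' C : MulChar F ℂ) (x : F) :
    AppellF1 A B B' C x 1 =
      (A * B') (-1) * binom B' (A⁻¹ * C) * twoF1 A B (C * B'⁻¹) x
      + ((Fintype.card F : ℂ) - 1) * A⁻¹ x * B' (-1) * δchar (A * C⁻¹ * B') := by
  by_cases hx : x = 0
  · subst hx
    simp [AppellF1, twoF1, MulChar.map_zero]
  have hD : B * (C * B⁻¹ * B'⁻¹) * A⁻¹ = C * B'⁻¹ * A⁻¹ := by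
    rw [show B * (C * B⁻¹ * B'⁻¹) * A⁻¹ = B * B⁻¹ * (C * B'⁻¹ * A⁻¹) by
      ac_rfl, mul_inv_cancel, one_mul]
  have hD' : B⁻¹ * (C * B'⁻¹) = C * B⁻¹ * B'⁻¹ := by ac_rfl
  have hδ : δchar (C * B'⁻¹ * A⁻¹) = δchar (A * C⁻¹ * B') := by
    have : A * C⁻¹ * B' = (C * B'⁻¹ * A⁻¹)⁻¹ := by
      simp only [mul_inv, inv_inv]; ac_rfl
    simp only [δchar, this, inv_eq_one]
  have hsign : C (-1) * A (-1) * δchar (A * C⁻¹ * B') = B' (-1) * δchar (A * C⁻¹ * B') := by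
    unfold δchar
    split_ifs with h
    · have hC : C = A * B' := by
        rw [mul_right_comm, mul_inv_eq_one] at h
        exact h.symm
      rw [hC, MulChar.mul_apply, mul_one, mul_one]
      linear_combination B' (-1) * mulChar_neg_one_mul_self A
    · simp
  have hJ : J B' (C * B'⁻¹ * A⁻¹) = B' (-1) * J B' (A⁻¹ * C)⁻¹ := by
    rw [J_eq_neg_one_mul_J, show B' * (C * B'⁻¹ * A⁻¹) = B' * B'⁻¹ * (A⁻¹ * C) by ac_rfl,
      mul_inv_cancel, one_mul]
  have hsum : ∑ u : F, ∑ v : F,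
      B u * B' v * (C * B⁻¹ * B'⁻¹) (1 - u - v) * A⁻¹ (1 - u * x - v * 1) =
      J B' (C * B'⁻¹ * A⁻¹) *
        (∑ y : F, B y * (C * B⁻¹ * B'⁻¹) (1 - y) * A⁻¹ (1 - x * y)) +
      (C * B⁻¹ * B'⁻¹) (-1) * A⁻¹ (-1) * A⁻¹ x *
        (((Fintype.card F : ℂ) - 1) * δchar (A * C⁻¹ * B')) := by
    have hinner (v : F) : ∑ u : F,
        B u * B' v * (C * B⁻¹ * B'⁻¹) (1 - u - v) * A⁻¹ (1 - u * x - v * 1) =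
        B' v * ∑ u : F, B u * (C * B⁻¹ * B'⁻¹) (1 - v - u) * A⁻¹ (1 - v - u * x) := by
      rw [mul_sum]
      refine sum_congr rfl fun u _ => ?_
      rw [mul_one, sub_right_comm 1 u v, sub_right_comm 1 (u * x) v]
      ring
    rw [sum_comm]
    simp_rw [hinner, sum_mulChar_rescale, hD, hδ, mul_add, sum_add_distrib, ← mul_assoc,
      ← sum_mul, sub_eq_zero, mul_ite, mul_zero]
    rw [sum_ite_eq]
    simp [J, mul_assoc]
  rw [AppellF1, hsum, hJ, twoF1, binom, hD', mul_one]
  have h1 : (1 : MulChar F ℂ) x = 1 := MulChar.one_apply (Ne.isUnit hx)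
  rw [h1]
  simp only [MulChar.mul_apply _ _ (-1 : F), mulChar_inv_neg_one]
  set T := ∑ y : F, B y * (C * B⁻¹ * B'⁻¹) (1 - y) * A⁻¹ (1 - x * y)
  linear_combination
    -(B (-1) * B' (-1) ^ 2 * J B' (A⁻¹ * C)⁻¹ * T) *
      (C (-1) ^ 2 * mulChar_neg_one_mul_self A + mulChar_neg_one_mul_self C) +
    A⁻¹ x * ((Fintype.card F : ℂ) - 1) *
      (C (-1) * A (-1) * δchar (A * C⁻¹ * B') *
        (B' (-1) ^ 2 * mulChar_neg_one_mul_self B + mulChar_neg_one_mul_self B') + hsign)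

end FFAppell
end

section
/- Let B, B', C be multiplicative characters of F_q, x ∈ F_q^*, and y ∈ F_q^* with y ≠ 1. Then Σ_{λ,μ} binom(λμ, λ)·binom(B̄B̄'C, B̄'Cλ)·binom(B̄'Cλ, Cλμ)·λ(−x)·μ(−y) = (q−1)²·binom(B̄'C, C)·binom(B̄B̄'C, B̄'C) − (q−1)²·F₁(ε; B, B'; C; x, y) − (q−1)²·C(−1)·B'C̄(x/(1−y)) + (q−1)³·C(−1)·δ(B'C̄), where the double sum ranges over all multiplicative characters λ, μ of F_q. -/
open Finset

namespace FFAppell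

variable {F : Type*} [Field F] [Fintype F] [DecidableEq F]

set_option linter.unusedSectionVars false

/-- Orthogonality of the multiplicative characters of a finite field. -/
lemma sum_char_mul_char_inv (a b : F) :
    ∑ χ : MulChar F ℂ, χ a * χ⁻¹ b =
      if a = b ∧ b ≠ 0 then (Fintype.card F : ℂ) - 1 else 0 := by
  by_cases hb : b = 0
  · simp [hb, MulChar.map_zero]
  simp only [MulChar.inv_apply', ← map_mul]
  split_ifs with h
  · rw [h.1, mul_inv_cancel₀ hb]
    have hcard : Fintype.card (MulChar F ℂ) = Fintype.card F - 1 := by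
      rw [← Nat.card_eq_fintype_card, MulChar.card_eq_card_units_of_hasEnoughRootsOfUnity,
        Nat.card_eq_fintype_card, Fintype.card_units]
    simp [hcard, Nat.cast_sub Fintype.card_pos]
  · have hne : a * b⁻¹ ≠ 1 := fun h' ↦ h ⟨(mul_inv_eq_one₀ hb).mp h', hb⟩
    obtain ⟨χ, hχ⟩ := MulChar.exists_apply_ne_one_of_hasEnoughRootsOfUnity F ℂ hne
    refine eq_zero_of_mul_eq_self_left hχ ?_
    simp only [Finset.mul_sum, ← MulChar.mul_apply]
    exact Fintype.sum_bijective _ (Group.mulLeft_bijective χ) _ _ fun _ ↦ rfl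

lemma char_neg (χ : MulChar F ℂ) (a : F) : χ (-a) = χ (-1) * χ a := by
  rw [← map_mul, neg_one_mul]

lemma char_neg_one_mul_self (χ : MulChar F ℂ) : χ (-1) * χ (-1) = 1 := by
  rw [← map_mul]; simp

lemma char_ne_zero (χ : MulChar F ℂ) {a : F} (ha : a ≠ 0) : χ a ≠ 0 :=
  MulChar.apply_ne_zero_iff.mpr ha.isUnit

lemma char_inv_neg_one (χ : MulChar F ℂ) : (χ (-1))⁻¹ = χ (-1) :=
  inv_eq_of_mul_eq_one_left (char_neg_one_mul_self χ)

lemma char_inv (χ : MulChar F ℂ) (a : F) : χ a⁻¹ = (χ a)⁻¹ := by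
  rw [← MulChar.inv_apply', MulChar.inv_apply_eq_inv']

lemma J_comm (A D : MulChar F ℂ) : J A D = J D A := by
  unfold J
  refine Fintype.sum_equiv (Equiv.subLeft 1) _ _ fun u ↦ ?_
  simp [mul_comm]

/-- The symmetry of the Jacobi sum under `u ↦ u / (u - 1)`. -/
lemma J_eq_neg_one_mul (A D : MulChar F ℂ) : J A D = A (-1) * J A (A⁻¹ * D⁻¹) := by
  rw [J_comm A D, J_comm A (A⁻¹ * D⁻¹)]
  unfold J
  rw [Finset.mul_sum]
  refine Fintype.sum_equiv (Equiv.inv F) _ _ fun u ↦ ?_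
  by_cases hu : u = 0
  · simp [hu, MulChar.map_zero]
  have h : 1 - u = -1 * (u * (1 - u⁻¹)) := by field_simp; ring
  have := char_ne_zero A hu
  simp only [Equiv.inv_apply, MulChar.mul_apply, MulChar.inv_apply_eq_inv', char_inv]
  rw [h, map_mul, map_mul]
  field_simp

/-- The full double sum underlying the Appell function at `A = ε`. -/
lemma sum_sum_dirichlet (B B' K : MulChar F ℂ) :
    ∑ u : F, ∑ v : F, B u * B' v * (K * B⁻¹) (1 - u - v) =
      J B' K * J B (K * B⁻¹) + ((Fintype.card F : ℂ) - 1) * (K * B) (-1) * δchar K := by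
  have key (v : F) : ∑ u : F, B u * B' v * (K * B⁻¹) (1 - u - v) =
      B' v * K (1 - v) * J B (K * B⁻¹) +
        if v = 1 then ((Fintype.card F : ℂ) - 1) * (K * B) (-1) * δchar K else 0 := by
    split_ifs with hv
    · subst hv
      have h (u : F) : B u * B' 1 * (K * B⁻¹) (1 - u - 1) = (K * B) (-1) * K u := by
        rw [show (1 : F) - u - 1 = -u by ring, char_neg]
        by_cases hu : u = 0
        · simp [hu, MulChar.map_zero]
        have := char_ne_zero B hu
        simp only [MulChar.mul_apply, MulChar.inv_apply_eq_inv', char_inv_neg_one, map_one]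
        field_simp
      simp only [h, ← Finset.mul_sum, sub_self, MulChar.map_zero, mul_zero, zero_mul, zero_add]
      unfold δchar
      split_ifs with hK
      · subst hK
        rw [MulChar.sum_one_eq_card_units, Fintype.card_units, Nat.cast_sub Fintype.card_pos]
        push_cast
        ring
      · rw [MulChar.sum_eq_zero_of_ne_one hK]; ring
    · have hv' : 1 - v ≠ 0 := sub_ne_zero.mpr (Ne.symm hv)
      rw [add_zero, J, Finset.mul_sum]
      refine (Fintype.sum_equiv (Equiv.mulLeft₀ (1 - v) hv') _ _ fun u ↦ ?_).symm
      have h : 1 - (1 - v) * u - v = (1 - v) * (1 - u) := by ring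
      have := char_ne_zero B hv'
      simp only [Equiv.mulLeft₀_apply, h, map_mul, MulChar.mul_apply, MulChar.inv_apply_eq_inv']
      field_simp
  rw [Finset.sum_comm]
  simp only [key, Finset.sum_add_distrib, ← Finset.sum_mul, Finset.sum_ite_eq', Finset.mem_univ,
    if_true]
  rfl

/-- The part of the Appell double sum over the line `1 - u * x - v * y = 0`. -/
lemma sum_line (B B' K : MulChar F ℂ) {x y : F} (hx : x ≠ 0) :
    ∑ v : F, B ((1 - v * y) / x) * B' v * (K * B⁻¹) (1 - (1 - v * y) / x - v) =
      B (-1) * K⁻¹ x * ∑ z : F, (K * B⁻¹) (y - z - x * (1 - z)) * B (y - z) * (K * B')⁻¹ z := by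
  rw [Finset.mul_sum]
  refine Fintype.sum_equiv (Equiv.inv F) _ _ fun v ↦ ?_
  by_cases hv : v = 0
  · simp [hv, MulChar.map_zero]
  have h1 : 1 - (1 - v * y) / x - v = v * (y - v⁻¹ - x * (1 - v⁻¹)) * x⁻¹ := by
    field_simp; ring
  have h2 : (1 - v * y) / x = -1 * (v * (y - v⁻¹)) * x⁻¹ := by
    field_simp; ring
  have := char_ne_zero B hv
  have := char_ne_zero K hv
  have := char_ne_zero B' hv
  have := char_ne_zero B hx
  have := char_ne_zero K hx
  rw [h1, h2]
  simp only [Equiv.inv_apply, map_mul, MulChar.mul_apply, MulChar.inv_apply_eq_inv', char_inv]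
  field_simp

lemma appellF1_one_eq (B B' C : MulChar F ℂ) {x y : F} (hx : x ≠ 0) (hy : y ≠ 0) :
    AppellF1 (1 : MulChar F ℂ) B B' C x y =
      (B * B') (-1) * ((∑ u : F, ∑ v : F, B u * B' v * (B'⁻¹ * C * B⁻¹) (1 - u - v)) -
        ∑ v : F, B ((1 - v * y) / x) * B' v *
          (B'⁻¹ * C * B⁻¹) (1 - (1 - v * y) / x - v)) := by
  have hone (a : F) : (1 : MulChar F ℂ)⁻¹ a = 1 - if a = 0 then 1 else 0 := by
    split_ifs with ha
    · simp [ha, MulChar.map_zero]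
    · simp [MulChar.one_apply (Ne.isUnit ha)]
  have hline (u v : F) : 1 - u * x - v * y = 0 ↔ u = (1 - v * y) / x := by
    rw [eq_div_iff hx]
    constructor <;> intro h <;> linear_combination -h
  have hC : C * B⁻¹ * B'⁻¹ = B'⁻¹ * C * B⁻¹ := by
    rw [mul_comm, ← mul_assoc]
  unfold AppellF1
  rw [MulChar.one_apply (mul_ne_zero hx hy).isUnit, one_mul, hC]
  congr 1
  rw [Finset.sum_comm, Finset.sum_comm (f := fun u v ↦ B u * B' v * (B'⁻¹ * C * B⁻¹) (1 - u - v)),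
    ← Finset.sum_sub_distrib]
  refine Finset.sum_congr rfl fun v _ ↦ ?_
  simp only [hone, hline, mul_sub, mul_one, Finset.sum_sub_distrib, mul_ite, mul_zero,
    Finset.sum_ite_eq', Finset.mem_univ, if_true]

lemma binom_product_eq_sum (B K C lam mu : MulChar F ℂ) (x y : F) :
    binom (lam * mu) lam * binom (B⁻¹ * K) (K * lam) * binom (K * lam) (C * lam * mu) *
        lam (-x) * mu (-y) =
      ∑ w : F, ∑ s : F, ∑ t : F,
        ((K * C) (-1) * ((B⁻¹ * K) s * K⁻¹ (1 - s) * K t * C⁻¹ (1 - t))) *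
          ((lam (x * w * t) * lam⁻¹ ((1 - w) * (1 - s) * (1 - t))) *
            (mu (y * w) * mu⁻¹ (1 - t))) := by
  unfold binom J
  have h1 := char_neg_one_mul_self lam
  have h2 := char_neg_one_mul_self mu
  rw [char_neg lam x, char_neg mu y]
  trans ((lam (-1) * lam (-1)) * (lam (-1) * lam (-1)) * (mu (-1) * mu (-1)) * (K * C) (-1) *
    (lam x * mu y)) *
      ((∑ w : F, (lam * mu) w * lam⁻¹ (1 - w)) *
        ((∑ s : F, (B⁻¹ * K) s * (K * lam)⁻¹ (1 - s)) *
          ∑ t : F, (K * lam) t * (C * lam * mu)⁻¹ (1 - t)))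
  · simp only [MulChar.mul_apply]
    ring
  rw [h1, h2, Finset.sum_mul, Finset.mul_sum]
  refine Finset.sum_congr rfl fun w _ ↦ ?_
  rw [Finset.sum_mul, Finset.mul_sum, Finset.mul_sum]
  refine Finset.sum_congr rfl fun s _ ↦ ?_
  rw [Finset.mul_sum, Finset.mul_sum, Finset.mul_sum]
  refine Finset.sum_congr rfl fun t _ ↦ ?_
  simp only [MulChar.mul_apply, MulChar.inv_apply_eq_inv', map_mul, mul_inv]
  ring

lemma sum_sum_orthogonality (B K C : MulChar F ℂ) {x y : F} (hx : x ≠ 0) (hy : y ≠ 0) (w : F) :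
    ∑ s : F, ∑ t : F, ((B⁻¹ * K) s * K⁻¹ (1 - s) * K t * C⁻¹ (1 - t)) *
        ((if x * w * t = (1 - w) * (1 - s) * (1 - t) ∧ (1 - w) * (1 - s) * (1 - t) ≠ 0
            then (1 : ℂ) else 0) *
          (if y * w = 1 - t ∧ 1 - t ≠ 0 then 1 else 0)) =
      if y * w = 1 then 0 else
        K⁻¹ x * ((K * B⁻¹) (y - y * w - x * (1 - y * w)) * B (y - y * w) * C⁻¹ (y * w)) := by
  have ht (s : F) := Finset.sum_eq_single (s := univ) (f := fun t : F ↦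
      ((B⁻¹ * K) s * K⁻¹ (1 - s) * K t * C⁻¹ (1 - t)) *
        ((if x * w * t = (1 - w) * (1 - s) * (1 - t) ∧ (1 - w) * (1 - s) * (1 - t) ≠ 0
            then (1 : ℂ) else 0) *
          (if y * w = 1 - t ∧ 1 - t ≠ 0 then 1 else 0))) (1 - y * w)
    (fun t _ hne ↦ by
      rw [if_neg (fun h : y * w = 1 - t ∧ 1 - t ≠ 0 ↦ hne (by linear_combination h.1))]
      ring) (by simp)
  simp only [ht]
  by_cases hw0 : w = 0
  · simp [hw0, MulChar.map_zero]
  by_cases hyw : y * w = 1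
  · simp [hyw, MulChar.map_zero]
  by_cases hw1 : w = 1
  · simp [hw1, MulChar.map_zero]
  have hyw0 : y * w ≠ 0 := mul_ne_zero hy hw0
  have ht0 : 1 - y * w ≠ 0 := sub_ne_zero.mpr (Ne.symm hyw)
  have hw1' : 1 - w ≠ 0 := sub_ne_zero.mpr (Ne.symm hw1)
  set r : F := x * (1 - y * w) * (y * (1 - w))⁻¹ with hr
  have hr0 : r ≠ 0 := mul_ne_zero (mul_ne_zero hx ht0) (inv_ne_zero (mul_ne_zero hy hw1'))
  rw [Finset.sum_eq_single (1 - r), if_neg hyw]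
  · rw [if_pos, if_pos]
    · have h1 : y - y * w - x * (1 - y * w) = (y - y * w) * (1 - r) := by
        rw [hr]; field_simp
      have h2 : y - y * w = y * (1 - w) := by ring
      rw [h1, h2]
      have := char_ne_zero B hy
      have := char_ne_zero B hw1'
      have := char_ne_zero K hy
      have := char_ne_zero K hw1'
      have := char_ne_zero K ht0
      have := char_ne_zero K hx
      have h3 : K r = K x * K (1 - y * w) * (K y * K (1 - w))⁻¹ := by
        rw [hr, map_mul, map_mul, char_inv, map_mul]
      simp only [sub_sub_cancel, MulChar.mul_apply, MulChar.inv_apply_eq_inv', map_mul, h3]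
      field_simp
    · simpa using hyw0
    · simp only [sub_sub_cancel]
      refine ⟨?_, mul_ne_zero (mul_ne_zero hw1' hr0) hyw0⟩
      rw [hr]; field_simp
  · intro s _ hs
    rw [if_neg]
    · ring
    rintro ⟨h, -⟩
    apply hs
    have : (1 - s) = r := by
      rw [hr, eq_mul_inv_iff_mul_eq₀ (mul_ne_zero hy hw1')]
      apply mul_left_cancel₀ hw0
      linear_combination -h
    rw [← this]; ring
  · simp

lemma double_sum_eq_sum (B K C : MulChar F ℂ) {x y : F} (hx : x ≠ 0) (hy : y ≠ 0) :
    ∑ lam : MulChar F ℂ, ∑ mu : MulChar F ℂ,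
        binom (lam * mu) lam * binom (B⁻¹ * K) (K * lam) *
          binom (K * lam) (C * lam * mu) * lam (-x) * mu (-y) =
      ((Fintype.card F : ℂ) - 1) ^ 2 * (K * C) (-1) * K⁻¹ x *
        ((∑ z : F, (K * B⁻¹) (y - z - x * (1 - z)) * B (y - z) * C⁻¹ z) - K (y - 1)) := by
  have hswap (c : F → F → F → ℂ) (L M : F → F → F → MulChar F ℂ → ℂ) :
      ∑ lam : MulChar F ℂ, ∑ mu : MulChar F ℂ, ∑ w : F, ∑ s : F, ∑ t : F,
        c w s t * (L w s t lam * M w s t mu) =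
      ∑ w : F, ∑ s : F, ∑ t : F, c w s t * ((∑ lam, L w s t lam) * ∑ mu, M w s t mu) := by
    simp only [Finset.sum_comm (γ := MulChar F ℂ) (α := F), Finset.sum_mul_sum]
    simp only [Finset.mul_sum]
  have hite (p : Prop) [Decidable p] :
      (if p then (Fintype.card F : ℂ) - 1 else 0) =
        ((Fintype.card F : ℂ) - 1) * if p then 1 else 0 := by simp
  simp only [binom_product_eq_sum, hswap, sum_char_mul_char_inv]
  have hinner (w : F) := sum_sum_orthogonality B K C hx hy w
  trans ((Fintype.card F : ℂ) - 1) ^ 2 * (K * C) (-1) * ∑ w : F,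
      if y * w = 1 then 0 else
        K⁻¹ x * ((K * B⁻¹) (y - y * w - x * (1 - y * w)) * B (y - y * w) * C⁻¹ (y * w))
  · simp only [← hinner, Finset.mul_sum]
    refine Finset.sum_congr rfl fun w _ ↦ Finset.sum_congr rfl fun s _ ↦
      Finset.sum_congr rfl fun t _ ↦ ?_
    rw [hite, hite (y * w = 1 - t ∧ 1 - t ≠ 0)]
    ring
  rw [mul_assoc _ (K⁻¹ x)]
  congr 1
  rw [Fintype.sum_equiv (Equiv.mulLeft₀ y hy) _ (fun z ↦ if z = 1 then 0 else
    K⁻¹ x * ((K * B⁻¹) (y - z - x * (1 - z)) * B (y - z) * C⁻¹ z)) fun w ↦ by simp]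
  rw [← Finset.add_sum_erase univ (fun z ↦ (K * B⁻¹) (y - z - x * (1 - z)) * B (y - z) * C⁻¹ z)
    (mem_univ 1), ← Finset.add_sum_erase univ _ (mem_univ (1 : F)), if_pos rfl, zero_add]
  have h1 : (K * B⁻¹) (y - 1 - x * (1 - 1)) * B (y - 1) * C⁻¹ 1 = K (y - 1) := by
    by_cases h : y - 1 = 0
    · simp [h, MulChar.map_zero]
    have := char_ne_zero B h
    simp only [sub_self, mul_zero, sub_zero, MulChar.mul_apply, MulChar.inv_apply_eq_inv', map_one]
    field_simp
  rw [h1, add_sub_cancel_left, Finset.mul_sum]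
  refine Finset.sum_congr rfl fun z hz ↦ ?_
  rw [if_neg (Finset.ne_of_mem_erase hz)]

/-- Character double-sum identity (4.6) from the proof of the generating function. -/
theorem double_sum_identity_three (B B' C : MulChar F ℂ) (x y : F)
    (hx : x ≠ 0) (hy0 : y ≠ 0) (hy1 : y ≠ 1) :
    ∑ lam : MulChar F ℂ, ∑ mu : MulChar F ℂ,
        binom (lam * mu) lam * binom (B⁻¹ * B'⁻¹ * C) (B'⁻¹ * C * lam) *
          binom (B'⁻¹ * C * lam) (C * lam * mu) * lam (-x) * mu (-y) =
      ((Fintype.card F : ℂ) - 1) ^ 2 * binom (B'⁻¹ * C) C * binom (B⁻¹ * B'⁻¹ * C) (B'⁻¹ * C)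
      - ((Fintype.card F : ℂ) - 1) ^ 2 * AppellF1 (1 : MulChar F ℂ) B B' C x y
      - ((Fintype.card F : ℂ) - 1) ^ 2 * C (-1) * (B' * C⁻¹) (x / (1 - y))
      + ((Fintype.card F : ℂ) - 1) ^ 3 * C (-1) * δchar (B' * C⁻¹) := by
  have hδ : δchar (B' * C⁻¹) = δchar (B'⁻¹ * C) := by
    unfold δchar
    congr 1
    rw [← inv_eq_one (a := B' * C⁻¹), mul_inv, inv_inv]
  have hBC : B' * C⁻¹ = (B'⁻¹ * C)⁻¹ := by rw [mul_inv, inv_inv]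
  rw [hδ, hBC, appellF1_one_eq B B' C hx hy0, mul_assoc B⁻¹]
  have hC : C = B'⁻¹ * C * B' := by rw [mul_comm, mul_inv_cancel_left]
  generalize B'⁻¹ * C = K at *
  subst hC
  rw [double_sum_eq_sum B K _ hx hy0, sum_line B B' K hx, sum_sum_dirichlet]
  have hJ1 : J B' K = K (-1) * J K (K * B')⁻¹ := by
    rw [J_comm, J_eq_neg_one_mul, mul_inv]
  have hJ2 : J B (K * B⁻¹) = (K * B⁻¹) (-1) * J (B⁻¹ * K) K⁻¹ := by
    rw [J_comm, J_eq_neg_one_mul, mul_inv, inv_inv, mul_inv_cancel_right, mul_comm K B⁻¹]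
  have hy : 1 - y ≠ 0 := sub_ne_zero.mpr (Ne.symm hy1)
  have hK : K (y - 1) = K (-1) * K (1 - y) := by rw [← char_neg, neg_sub]
  have hxy : K⁻¹ (x / (1 - y)) = K⁻¹ x * K (1 - y) := by
    rw [div_eq_mul_inv, map_mul, MulChar.inv_apply' K (1 - y)⁻¹, inv_inv]
  rw [hJ1, hJ2, hK, hxy]
  unfold binom
  simp only [MulChar.mul_apply, MulChar.inv_apply_eq_inv' B (-1), char_inv_neg_one]
  have hb := char_neg_one_mul_self B
  have hb' := char_neg_one_mul_self B'
  have hk := char_neg_one_mul_self K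
  generalize (∑ z : F, K (y - z - x * (1 - z)) * B⁻¹ (y - z - x * (1 - z)) * B (y - z) *
    (K * B')⁻¹ z) = S
  grind

end FFAppell
end
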